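/- arXiv:1406.2754 — 2 statements merged into one kernel-verified Lean document; each statement's English description precedes it below -/
import Mathlib

section
/- There exists a distribution F on [0,∞) with finite positive mean μ = ∫₀^∞ F̄(y) dy such that: F ∈ 𝒟𝒦ᶜ but F ∉ 𝒪ℒ (hence F ∉ 𝒥) and F ∉ 𝒟𝒦₁; while the integrated tail distribution F^I satisfies F^I ∈ 𝒥, F^I ∈ 𝒟𝒦ᶜ, F^I ∉ 𝒟𝒦₁, F^I ∉ ℒ, F^I ∉ 𝒟, and F^I is not weakly tail equivalent to any subexponential distribution. -/
open MeasureTheory Filter Set Topology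

noncomputable section

/-- The (real-valued) tail function of a measure `F` on `ℝ`: `F̄(x) = F((x,∞))`. -/
def tail (F : Measure ℝ) (x : ℝ) : ℝ := (F (Set.Ioi x)).toReal

/-- A distribution: a Borel probability measure on `[0,∞)` with unbounded support. -/
def IsDistribution (F : Measure ℝ) : Prop :=
  IsProbabilityMeasure F ∧ F (Set.Iio 0) = 0 ∧ ∀ x : ℝ, 0 < F (Set.Ioi x)

/-- The convolution `F*2` of `F` with itself: the law of `X₁ + X₂` for independent `X₁, X₂ ∼ F`. -/
def conv2 (F : Measure ℝ) : Measure ℝ := (F.prod F).map fun p => p.1 + p.2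

/-- Heavy-tailed (class 𝒦): all exponential moments are infinite. -/
def HeavyTailed (F : Measure ℝ) : Prop :=
  ∀ a : ℝ, 0 < a → ∫⁻ y, ENNReal.ofReal (Real.exp (a * y)) ∂F = ⊤

/-- Class 𝒪𝒮 (generalized subexponential): `limsup F̄*²(x)/F̄(x) < ∞`. -/
def MemOS (F : Measure ℝ) : Prop :=
  Filter.atTop.limsup (fun x : ℝ => conv2 F (Set.Ioi x) / F (Set.Ioi x)) < ⊤

/-- Class 𝒟𝒦ᶜ (strongly heavy-tailed): `e^{λx} F̄(x) → ∞` for every `λ > 0`. -/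
def StronglyHeavyTailed (F : Measure ℝ) : Prop :=
  ∀ l : ℝ, 0 < l →
    Filter.Tendsto (fun x : ℝ => Real.exp (l * x) * tail F x) Filter.atTop Filter.atTop

/-- Class 𝒟𝒦₁: `x^δ F̄(x) → ∞` for some `δ > 0`. -/
def MemDK1 (F : Measure ℝ) : Prop :=
  ∃ δ : ℝ, 0 < δ ∧
    Filter.Tendsto (fun x : ℝ => x ^ δ * tail F x) Filter.atTop Filter.atTop

/-- Class ℒ (long-tailed): `F̄(x-t)/F̄(x) → 1` for every `t > 0`. -/
def MemL (F : Measure ℝ) : Prop :=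
  ∀ t : ℝ, 0 < t →
    Filter.Tendsto (fun x : ℝ => tail F (x - t) / tail F x) Filter.atTop (nhds 1)

/-- Class 𝒟 (dominatedly varying): `limsup F̄(x/2)/F̄(x) < ∞`. -/
def MemD (F : Measure ℝ) : Prop :=
  Filter.atTop.limsup (fun x : ℝ => F (Set.Ioi (x / 2)) / F (Set.Ioi x)) < ⊤

/-- Class 𝒪ℒ (generalized long-tailed): `limsup F̄(x-t)/F̄(x) < ∞` for every `t > 0`. -/
def MemOL (F : Measure ℝ) : Prop :=
  ∀ t : ℝ, 0 < t →
    Filter.atTop.limsup (fun x : ℝ => F (Set.Ioi (x - t)) / F (Set.Ioi x)) < ⊤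

/-- Class 𝒮 (subexponential): `F̄*²(x)/F̄(x) → 2`. -/
def MemS (F : Measure ℝ) : Prop :=
  Filter.Tendsto (fun x : ℝ => (conv2 F (Set.Ioi x)).toReal / tail F x)
    Filter.atTop (nhds 2)

/-- Class 𝒥 (principle of a single big jump, for `n = 2`):
`lim_{K→∞} liminf_{x→∞} P(min(X₁,X₂) ≤ K | X₁+X₂ > x) = 1` for independent `X₁, X₂ ∼ F`. -/
def MemJ (F : Measure ℝ) : Prop :=
  Filter.Tendsto (fun K : ℝ => Filter.atTop.liminf (fun x : ℝ =>
      ((F.prod F) {p : ℝ × ℝ | min p.1 p.2 ≤ K ∧ x < p.1 + p.2}).toReal /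
      ((F.prod F) {p : ℝ × ℝ | x < p.1 + p.2}).toReal))
    Filter.atTop (nhds 1)

/-- Weak tail equivalence: `0 < liminf F̄(x)/Ḡ(x) ≤ limsup F̄(x)/Ḡ(x) < ∞`. -/
def WeakTailEquiv (F G : Measure ℝ) : Prop :=
  0 < Filter.atTop.liminf (fun x : ℝ => F (Set.Ioi x) / G (Set.Ioi x)) ∧
  Filter.atTop.limsup (fun x : ℝ => F (Set.Ioi x) / G (Set.Ioi x)) < ⊤

/-- The heights `2^{-n(n-1)/2}` of the steps of the tail function. -/
def stepHeight : ℕ → ℝ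
  | 0 => 1
  | n + 1 => stepHeight n / 2 ^ n

lemma stepHeight_pos (n : ℕ) : 0 < stepHeight n := by
  induction n with
  | zero => simp [stepHeight]
  | succ n ih => rw [stepHeight]; positivity

lemma stepHeight_succ_mul (n : ℕ) : stepHeight (n + 1) * 2 ^ n = stepHeight n := by
  rw [stepHeight]; field_simp

lemma stepHeight_antitone : Antitone stepHeight := by
  refine antitone_nat_of_succ_le fun n => ?_
  have h := stepHeight_succ_mul n
  have h1 : (1 : ℝ) ≤ 2 ^ n := one_le_pow₀ (by norm_num)
  nlinarith [stepHeight_pos (n + 1)]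

lemma stepHeight_mul_pow_le (k : ℕ) : ∃ C : ℝ, 1 ≤ C ∧ ∀ n, stepHeight n * (2 ^ n) ^ k ≤ C := by
  induction k with
  | zero =>
    refine ⟨1, le_rfl, fun n => ?_⟩
    simpa [stepHeight] using stepHeight_antitone (Nat.zero_le n)
  | succ k ih =>
    obtain ⟨C, hC, h⟩ := ih
    have h2 : (1 : ℝ) ≤ 2 ^ (k + 1) := one_le_pow₀ (by norm_num)
    refine ⟨C * 2 ^ (k + 1), by nlinarith, fun n => ?_⟩
    cases n with
    | zero => simp only [stepHeight, pow_zero, one_pow]; nlinarith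
    | succ n =>
      have h1 : stepHeight (n + 1) * (2 ^ (n + 1)) ^ (k + 1)
          = (stepHeight n * (2 ^ n) ^ k) * 2 ^ (k + 1) := by
        rw [← stepHeight_succ_mul n]; ring
      rw [h1]
      exact mul_le_mul_of_nonneg_right (h n) (by positivity)

lemma stepHeight_tendsto : Tendsto stepHeight atTop (𝓝 0) := by
  obtain ⟨C, -, h⟩ := stepHeight_mul_pow_le 1
  have h1 : Tendsto (fun n : ℕ => C * (1 / 2 : ℝ) ^ n) atTop (𝓝 0) := by
    simpa using (tendsto_pow_atTop_nhds_zero_of_lt_one (r := (1 / 2 : ℝ))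
      (by norm_num) (by norm_num)).const_mul C
  refine squeeze_zero (fun n => (stepHeight_pos n).le) (fun n => ?_) h1
  have h2 := h n
  rw [pow_one, ← le_div_iff₀ (by positivity)] at h2
  refine h2.trans_eq ?_
  rw [one_div, inv_pow]; rfl

lemma stepHeight_mul_four_pow_le {n k : ℕ} (hn : 1 ≤ n) (hk : n + 1 ≤ k) :
    stepHeight k * (2 ^ k) ^ 2 ≤ 4 * stepHeight n * 2 ^ n := by
  induction k, hk using Nat.le_induction with
  | base =>
    rw [← stepHeight_succ_mul n]
    apply le_of_eq
    ring
  | succ k hk ih =>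
    refine le_trans ?_ ih
    have h4 : (4 : ℝ) ≤ 2 ^ k := by
      calc (4 : ℝ) = 2 ^ 2 := by norm_num
        _ ≤ 2 ^ k := pow_le_pow_right₀ (by norm_num) (by omega)
    rw [← stepHeight_succ_mul k, show (2 : ℝ) ^ (k + 1) = 2 ^ k * 2 from pow_succ _ _]
    have h5 : 0 < stepHeight (k + 1) * (2 ^ k) ^ 2 := mul_pos (stepHeight_pos _) (by positivity)
    nlinarith

/-- The tail function, equal to `stepHeight (n + 1)` on `[2^n, 2^(n+1))`. -/
def stepTail (x : ℝ) : ℝ := stepHeight (Nat.size ⌊x⌋₊)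

lemma size_floor_le {x : ℝ} {n : ℕ} : Nat.size ⌊x⌋₊ ≤ n ↔ x < 2 ^ n := by
  rw [Nat.size_le, Nat.floor_lt' (by positivity)]
  push_cast
  rfl

lemma lt_two_pow_size_floor (x : ℝ) : x < 2 ^ Nat.size ⌊x⌋₊ := size_floor_le.1 le_rfl

lemma stepTail_pos (x : ℝ) : 0 < stepTail x := stepHeight_pos _

lemma stepTail_antitone : Antitone stepTail := fun _ _ h =>
  stepHeight_antitone (size_floor_le.2 (h.trans_lt (lt_two_pow_size_floor _)))

lemma stepTail_eq {x : ℝ} {n : ℕ} (h1 : 2 ^ n ≤ x) (h2 : x < 2 ^ (n + 1)) :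
    stepTail x = stepHeight (n + 1) := by
  rw [stepTail, le_antisymm (size_floor_le.2 h2)]
  by_contra! h
  exact absurd (size_floor_le.1 (Nat.lt_succ_iff.1 h)) (not_lt.2 h1)

lemma stepTail_of_lt_one {x : ℝ} (h : x < 1) : stepTail x = 1 := by
  have : Nat.size ⌊x⌋₊ = 0 := Nat.le_zero.1 (size_floor_le.2 (by simpa using h))
  rw [stepTail, this, stepHeight]

lemma stepTail_two_pow (n : ℕ) : stepTail (2 ^ n) = stepHeight (n + 1) :=
  stepTail_eq le_rfl (pow_lt_pow_right₀ (by norm_num) (by omega))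

lemma stepTail_two_pow_sub {n : ℕ} {t : ℝ} (ht : 0 < t) (ht' : t ≤ 2 ^ n) :
    stepTail (2 ^ (n + 1) - t) = stepHeight (n + 1) :=
  stepTail_eq (by rw [pow_succ]; linarith) (by linarith)

lemma exists_two_pow_le {x : ℝ} (hx : 1 ≤ x) : ∃ n : ℕ, (2 : ℝ) ^ n ≤ x ∧ x < 2 ^ (n + 1) :=
  exists_nat_pow_near hx (by norm_num)

lemma stepTail_mul_pow_le (k : ℕ) :
    ∃ C : ℝ, 1 ≤ C ∧ ∀ x, 0 ≤ x → stepTail x * x ^ k ≤ C := by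
  obtain ⟨C, hC, h⟩ := stepHeight_mul_pow_le k
  refine ⟨C, hC, fun x hx => (h (Nat.size ⌊x⌋₊)).trans' ?_⟩
  exact mul_le_mul_of_nonneg_left (pow_le_pow_left₀ hx (lt_two_pow_size_floor x).le k)
    (stepHeight_pos _).le

/-- The discrete law on the powers of two with tail function `stepTail`. -/
def stepLaw : Measure ℝ :=
  Measure.sum fun n : ℕ =>
    ENNReal.ofReal (stepHeight n - stepHeight (n + 1)) • Measure.dirac ((2 : ℝ) ^ n)

lemma stepLaw_Ioi (x : ℝ) : stepLaw (Ioi x) = ENNReal.ofReal (stepTail x) := by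
  set m := Nat.size ⌊x⌋₊ with hm
  set g : ℕ → ℝ := fun n => stepHeight (max m n) with hg
  have hmono : ∀ n, 0 ≤ g n - g (n + 1) := fun n =>
    sub_nonneg.2 (stepHeight_antitone (max_le_max_left _ (Nat.le_succ n)))
  have hsum : HasSum (fun n => g n - g (n + 1)) (stepHeight m) := by
    rw [hasSum_iff_tendsto_nat_of_nonneg hmono]
    simp only [Finset.sum_range_sub']
    have h1 : Tendsto g atTop (𝓝 0) :=
      stepHeight_tendsto.comp (tendsto_atTop_mono (fun n => le_max_right m n) tendsto_id)
    simpa [hg] using h1.const_sub (stepHeight m)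
  rw [stepLaw, Measure.sum_apply _ measurableSet_Ioi, stepTail, ← hm, ← hsum.tsum_eq,
    ENNReal.ofReal_tsum_of_nonneg hmono hsum.summable]
  refine tsum_congr fun n => ?_
  rw [Measure.smul_apply, Measure.dirac_apply' _ measurableSet_Ioi, smul_eq_mul]
  by_cases h : m ≤ n
  · have h1 : (2 : ℝ) ^ n ∈ Ioi x := size_floor_le.1 h
    simp [hg, h1, h, h.trans (Nat.le_succ n)]
  · have h1 : (2 : ℝ) ^ n ∉ Ioi x := fun h' => h (size_floor_le.2 h')
    simp [hg, h1, (not_le.1 h).le, Nat.succ_le_of_lt (not_le.1 h)]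

lemma tail_stepLaw (x : ℝ) : tail stepLaw x = stepTail x := by
  rw [tail, stepLaw_Ioi, ENNReal.toReal_ofReal (stepTail_pos x).le]

lemma stepLaw_isDistribution : IsDistribution stepLaw := by
  refine ⟨⟨?_⟩, ?_, fun x => ?_⟩
  · have h : Tendsto (fun n : ℕ => stepLaw (Ioi (-(n : ℝ)))) atTop
        (𝓝 (stepLaw (⋃ n : ℕ, Ioi (-(n : ℝ))))) :=
      tendsto_measure_iUnion_atTop fun i j h => Ioi_subset_Ioi (by simpa using h)
    have h2 : (⋃ n : ℕ, Ioi (-(n : ℝ))) = univ := by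
      refine eq_univ_of_forall fun x => mem_iUnion.2 ?_
      obtain ⟨n, hn⟩ := exists_nat_gt (-x)
      exact ⟨n, by simpa [neg_lt] using hn⟩
    rw [h2] at h
    refine tendsto_nhds_unique h (tendsto_const_nhds.congr fun n => ?_)
    have : -(n : ℝ) < 1 := by linarith [(Nat.cast_nonneg n : (0 : ℝ) ≤ n)]
    rw [stepLaw_Ioi, stepTail_of_lt_one this, ENNReal.ofReal_one]
  · rw [stepLaw, Measure.sum_apply _ measurableSet_Iio, ENNReal.tsum_eq_zero]
    intro n
    have h1 : ¬ ((2 : ℝ) ^ n < 0) := not_lt.2 (by positivity)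
    simp [h1]
  · rw [stepLaw_Ioi, ENNReal.ofReal_pos]
    exact stepTail_pos x

lemma setLIntegral_Ioi_const_div_sq {x B : ℝ} (hx : 0 < x) (hB : 0 ≤ B) :
    ∫⁻ y in Ioi x, ENNReal.ofReal (B / y ^ 2) = ENNReal.ofReal (B / x) := by
  have heq : ∀ y ∈ Ioi x, B / y ^ 2 = B * y ^ (-2 : ℝ) := fun y hy => by
    rw [Real.rpow_neg (hx.trans hy).le, div_eq_mul_inv]; norm_num
  have hInt : IntegrableOn (fun y : ℝ => B * y ^ (-2 : ℝ)) (Ioi x) :=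
    (integrableOn_Ioi_rpow_of_lt (by norm_num) hx).const_mul B
  rw [setLIntegral_congr_fun measurableSet_Ioi fun y hy => congrArg ENNReal.ofReal (heq y hy),
    ← ofReal_integral_eq_lintegral_ofReal hInt, integral_const_mul,
    integral_Ioi_rpow_of_lt (by norm_num) hx]
  · congr 1
    norm_num [Real.rpow_neg hx.le, div_eq_mul_inv]
  · filter_upwards [ae_restrict_mem measurableSet_Ioi] with y hy
    exact mul_nonneg hB (Real.rpow_nonneg (hx.trans hy).le _)

/-- The unnormalised integrated tail `∫_x^∞ stepTail`. -/
def intTail (x : ℝ) : ℝ := (∫⁻ y in Ioi x, ENNReal.ofReal (stepTail y)).toReal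

lemma setLIntegral_stepTail_le {x B : ℝ} (hx : 0 < x) (hB : 0 ≤ B)
    (h : ∀ y, x < y → stepTail y * y ^ 2 ≤ B) :
    ∫⁻ y in Ioi x, ENNReal.ofReal (stepTail y) ≤ ENNReal.ofReal (B / x) := by
  rw [← setLIntegral_Ioi_const_div_sq hx hB]
  refine setLIntegral_mono' measurableSet_Ioi fun y hy => ENNReal.ofReal_le_ofReal ?_
  have hy0 : 0 < y := hx.trans hy
  rw [le_div_iff₀ (by positivity)]
  exact h y hy

lemma setLIntegral_stepTail_eq_add {x y c : ℝ} (hxy : x ≤ y)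
    (hc : ∀ z, x ≤ z → z < y → stepTail z = c) :
    ∫⁻ z in Ioi x, ENNReal.ofReal (stepTail z) =
      ENNReal.ofReal c * ENNReal.ofReal (y - x)
        + ∫⁻ z in Ioi y, ENNReal.ofReal (stepTail z) := by
  rw [← Ioc_union_Ioi_eq_Ioi hxy, lintegral_union measurableSet_Ioi
    (Set.disjoint_left.2 fun z hz hz' => not_lt.2 hz.2 hz'),
    setLIntegral_congr Ioo_ae_eq_Ioc.symm, setLIntegral_congr_fun (g := fun _ => ENNReal.ofReal c)
      measurableSet_Ioo fun z hz => by simp only [hc z hz.1.le hz.2]]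
  simp

lemma setLIntegral_stepTail_zero_lt_top :
    ∫⁻ y in Ioi (0 : ℝ), ENNReal.ofReal (stepTail y) < ⊤ := by
  obtain ⟨C, hC, h⟩ := stepTail_mul_pow_le 2
  rw [setLIntegral_stepTail_eq_add zero_le_one fun z _ hz => stepTail_of_lt_one hz]
  refine ENNReal.add_lt_top.2 ⟨by simp, ?_⟩
  exact (setLIntegral_stepTail_le one_pos (by linarith)
    fun y hy => h y (by linarith)).trans_lt ENNReal.ofReal_lt_top

lemma setLIntegral_stepTail {x : ℝ} (hx : 0 ≤ x) :
    ∫⁻ y in Ioi x, ENNReal.ofReal (stepTail y) = ENNReal.ofReal (intTail x) :=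
  (ENNReal.ofReal_toReal ((lintegral_mono_set (Ioi_subset_Ioi hx)).trans_lt
    setLIntegral_stepTail_zero_lt_top).ne).symm

lemma intTail_nonneg (x : ℝ) : 0 ≤ intTail x := ENNReal.toReal_nonneg

lemma intTail_le {x B : ℝ} (hx : 0 < x) (hB : 0 ≤ B)
    (h : ∀ y, x < y → stepTail y * y ^ 2 ≤ B) : intTail x ≤ B / x :=
  ENNReal.toReal_le_of_le_ofReal (by positivity) (setLIntegral_stepTail_le hx hB h)

lemma intTail_eq_add {x y c : ℝ} (hx : 0 ≤ x) (hxy : x ≤ y) (hc0 : 0 ≤ c)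
    (hc : ∀ z, x ≤ z → z < y → stepTail z = c) :
    intTail x = c * (y - x) + intTail y := by
  have h := setLIntegral_stepTail_eq_add hxy hc
  rw [setLIntegral_stepTail hx, setLIntegral_stepTail (hx.trans hxy), ← ENNReal.ofReal_mul hc0,
    ← ENNReal.ofReal_add (mul_nonneg hc0 (sub_nonneg.2 hxy)) (intTail_nonneg y)] at h
  exact (ENNReal.ofReal_eq_ofReal_iff (intTail_nonneg x)
    (add_nonneg (mul_nonneg hc0 (sub_nonneg.2 hxy)) (intTail_nonneg y))).1 h

lemma intTail_mul_pow_le (k : ℕ) : ∃ C : ℝ, 1 ≤ C ∧ ∀ x, 1 ≤ x → intTail x * x ^ k ≤ C := by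
  obtain ⟨C, hC, h⟩ := stepTail_mul_pow_le (k + 2)
  refine ⟨C, hC, fun x hx => ?_⟩
  have hx0 : 0 < x := by linarith
  have h1 : intTail x ≤ C / x ^ k / x := by
    refine intTail_le hx0 (by positivity) fun y hy => ?_
    rw [le_div_iff₀ (by positivity)]
    calc stepTail y * y ^ 2 * x ^ k ≤ stepTail y * y ^ 2 * y ^ k := by
          have := (stepTail_pos y).le
          gcongr
      _ = stepTail y * y ^ (k + 2) := by ring
      _ ≤ C := h y (by linarith)
  rw [← le_div_iff₀ (by positivity)]
  exact h1.trans (div_le_self (by positivity) hx)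

lemma intTail_eq_of_mem {x : ℝ} {n : ℕ} (h1 : 2 ^ n ≤ x) (h2 : x ≤ 2 ^ (n + 1)) :
    intTail x = stepHeight (n + 1) * (2 ^ (n + 1) - x) + intTail (2 ^ (n + 1)) :=
  intTail_eq_add ((by positivity : (0 : ℝ) ≤ 2 ^ n).trans h1) h2 (stepHeight_pos _).le
    fun _ hz hz' => stepTail_eq (h1.trans hz) hz'

lemma stepHeight_le_intTail (n : ℕ) : stepHeight n ≤ intTail (2 ^ n) := by
  have h := intTail_eq_of_mem (n := n) le_rfl (pow_le_pow_right₀ (by norm_num) (by omega))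
  rw [h, pow_succ, ← stepHeight_succ_mul n]
  linarith [intTail_nonneg (2 ^ n * 2)]

lemma intTail_two_pow_le {n : ℕ} (hn : 1 ≤ n) : intTail (2 ^ n) ≤ 4 * stepHeight n := by
  have h0 := stepHeight_pos n
  have h : intTail (2 ^ n) ≤ (4 * stepHeight n * 2 ^ n) / 2 ^ n := by
    refine intTail_le (by positivity) (by positivity) fun y hy => ?_
    have hk : n + 1 ≤ Nat.size ⌊y⌋₊ := by
      by_contra! h'
      exact absurd (size_floor_le.1 (Nat.lt_succ_iff.1 h')) (not_lt.2 hy.le)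
    refine (stepHeight_mul_four_pow_le hn hk).trans' ?_
    exact mul_le_mul_of_nonneg_left (pow_le_pow_left₀ (hy.le.trans' (by positivity))
      (lt_two_pow_size_floor y).le 2) (stepTail_pos y).le
  rwa [mul_div_cancel_right₀ _ (by positivity)] at h

lemma intTail_le_of_mem {x : ℝ} {n : ℕ} (h1 : 2 ^ n ≤ x) (h2 : x ≤ 2 ^ (n + 1)) :
    intTail x ≤ stepHeight (n + 1) * (2 ^ (n + 1) - x + 4) := by
  rw [intTail_eq_of_mem h1 h2]
  linarith [intTail_two_pow_le (Nat.le_add_left 1 n)]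

lemma le_intTail_of_mem {x : ℝ} {n : ℕ} (h1 : 2 ^ n ≤ x) (h2 : x ≤ 2 ^ (n + 1)) :
    stepHeight (n + 1) * (2 ^ (n + 1) - x + 1) ≤ intTail x := by
  rw [intTail_eq_of_mem h1 h2]
  linarith [stepHeight_le_intTail (n + 1)]

lemma stepTail_le_intTail {x : ℝ} (hx : 0 ≤ x) : stepTail x ≤ intTail x := by
  rcases lt_or_ge x 1 with h | h
  · rw [stepTail_of_lt_one h, intTail_eq_add hx h.le zero_le_one
      fun z _ hz => stepTail_of_lt_one hz]
    have := stepHeight_le_intTail 0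
    simp only [stepHeight, pow_zero] at this
    linarith
  · obtain ⟨n, h1, h2⟩ := exists_two_pow_le h
    rw [stepTail_eq h1 h2]
    refine (le_intTail_of_mem h1 h2.le).trans' ?_
    nlinarith [stepHeight_pos (n + 1)]

lemma intTail_pos {x : ℝ} (hx : 0 ≤ x) : 0 < intTail x :=
  (stepTail_pos x).trans_le (stepTail_le_intTail hx)

lemma intTail_sub_le {x y : ℝ} (hx : 2 ≤ x) (hy : 0 ≤ y) (hyx : y ≤ x / 2) :
    intTail (x - y) ≤ 4 * (1 + y) ^ 2 * intTail x := by
  obtain ⟨n, h1, h2⟩ := exists_two_pow_le (by linarith : 1 ≤ x)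
  have hlow := le_intTail_of_mem h1 h2.le
  set w := stepHeight (n + 1) with hw
  have hwpos : 0 < w := stepHeight_pos _
  have hwS : w ≤ intTail x := by nlinarith
  rcases le_or_gt (2 ^ n) (x - y) with h | h
  · refine (intTail_le_of_mem h (by linarith)).trans ?_
    rw [← hw]
    calc w * (2 ^ (n + 1) - (x - y) + 4)
        ≤ w * (2 ^ (n + 1) - x + 1) + w * (y + 3) := by linarith
      _ ≤ intTail x + intTail x * (y + 3) := by gcongr
      _ ≤ 4 * (1 + y) ^ 2 * intTail x := by nlinarith [mul_nonneg hy hy]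
  · obtain ⟨m, rfl⟩ : ∃ m, n = m + 1 := by
      refine Nat.exists_eq_succ_of_ne_zero fun h0 => ?_
      subst h0
      norm_num at h
      linarith
    have h3 : (2 : ℝ) ^ m ≤ x - y := by
      have : (2 : ℝ) ^ (m + 1) = 2 ^ m * 2 := pow_succ _ _
      linarith
    have h4 : stepHeight (m + 1) = w * 2 ^ (m + 1) := (stepHeight_succ_mul _).symm
    have h5 : stepHeight (m + 1) ≤ (1 + y) * intTail x := by
      rw [h4]
      have h6 : (2 : ℝ) ^ (m + 1 + 1) = 2 ^ (m + 1) * 2 := pow_succ _ _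
      calc w * 2 ^ (m + 1) ≤ w * (2 ^ (m + 1 + 1) - x + 1) + w * y := by
            rw [h6]; nlinarith
        _ ≤ intTail x + intTail x * y := by gcongr
        _ = (1 + y) * intTail x := by ring
    calc intTail (x - y) ≤ stepHeight (m + 1) * (2 ^ (m + 1) - (x - y) + 4) :=
          intTail_le_of_mem h3 h.le
      _ ≤ stepHeight (m + 1) * (4 * (1 + y)) :=
          mul_le_mul_of_nonneg_left (by linarith) (stepHeight_pos _).le
      _ ≤ ((1 + y) * intTail x) * (4 * (1 + y)) := by gcongr
      _ = 4 * (1 + y) ^ 2 * intTail x := by ring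

lemma le_intTail_two_pow_sub {n : ℕ} {t : ℝ} (ht : 0 ≤ t) (htn : t ≤ 2 ^ n) :
    t / 4 * intTail (2 ^ (n + 1)) ≤ intTail (2 ^ (n + 1) - t) := by
  rw [intTail_eq_of_mem (n := n) (x := 2 ^ (n + 1) - t) (by rw [pow_succ]; linarith) (by linarith)]
  have h1 := intTail_two_pow_le (Nat.le_add_left 1 n)
  have h2 := intTail_nonneg (2 ^ (n + 1))
  nlinarith [mul_le_mul_of_nonneg_left h1 ht]

lemma exp_mul_stepTail_tendsto {l : ℝ} (hl : 0 < l) :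
    Tendsto (fun x : ℝ => Real.exp (l * x) * stepTail x) atTop atTop := by
  set c : ℕ → ℝ := fun n => Real.exp (l / 4 * 2 ^ n) * stepHeight n with hc
  have hcpos : ∀ n, 0 < c n := fun n => mul_pos (Real.exp_pos _) (stepHeight_pos n)
  have hev : ∀ᶠ n : ℕ in atTop, (n : ℝ) / 2 ^ n < l / 4 := by
    have := (tendsto_pow_const_div_const_pow_of_one_lt 1 (r := (2 : ℝ)) (by norm_num)).eventually
      (gt_mem_nhds (show (0 : ℝ) < l / 4 by positivity))
    simpa using this
  obtain ⟨N, hN⟩ := eventually_atTop.1 hev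
  have hmono : ∀ n, N ≤ n → c n ≤ c (n + 1) := fun n hn => by
    have h1 : (n : ℝ) ≤ l / 4 * 2 ^ n := ((div_lt_iff₀ (by positivity)).1 (hN n hn)).le
    have h2 : (2 : ℝ) ^ n ≤ Real.exp (l / 4 * 2 ^ n) := by
      calc (2 : ℝ) ^ n ≤ Real.exp 1 ^ n :=
            pow_le_pow_left₀ (by norm_num) (by linarith [Real.add_one_le_exp (1 : ℝ)]) n
        _ = Real.exp n := by rw [← Real.exp_nat_mul, mul_one]
        _ ≤ _ := Real.exp_le_exp.2 h1
    calc c n = Real.exp (l / 4 * 2 ^ n) * stepHeight (n + 1) * 2 ^ n := by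
          rw [mul_assoc, stepHeight_succ_mul]
      _ ≤ Real.exp (l / 4 * 2 ^ n) * stepHeight (n + 1) * Real.exp (l / 4 * 2 ^ n) := by
          have := (stepHeight_pos (n + 1)).le
          gcongr
      _ = c (n + 1) := by
          simp only [hc]
          rw [mul_right_comm, ← Real.exp_add, pow_succ]
          congr 2
          ring
  have hlow : ∀ n, N ≤ n → c N ≤ c n := fun n hn => by
    induction n, hn using Nat.le_induction with
    | base => exact le_rfl
    | succ n hn ih => exact ih.trans (hmono n hn)
  have hlim : Tendsto (fun x : ℝ => c N * Real.exp (l / 2 * x)) atTop atTop :=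
    (Real.tendsto_exp_atTop.comp (tendsto_id.const_mul_atTop (by positivity))).const_mul_atTop
      (hcpos N)
  refine tendsto_atTop_mono' _ ?_ hlim
  filter_upwards [eventually_ge_atTop ((2 : ℝ) ^ N), eventually_ge_atTop (1 : ℝ)] with x hx hx1
  obtain ⟨n, h1, h2⟩ := exists_two_pow_le hx1
  have hn : N ≤ n + 1 := by
    by_contra! h
    exact absurd (h2.trans_le ((pow_le_pow_right₀ (by norm_num) h.le).trans hx)) (lt_irrefl x)
  rw [stepTail_eq h1 h2]
  calc c N * Real.exp (l / 2 * x) ≤ c (n + 1) * Real.exp (l / 2 * x) := by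
        have := hlow _ hn
        gcongr
    _ = Real.exp (l / 4 * 2 ^ (n + 1) + l / 2 * x) * stepHeight (n + 1) := by
        rw [Real.exp_add]; simp only [hc]; ring
    _ ≤ Real.exp (l * x) * stepHeight (n + 1) := by
        refine mul_le_mul_of_nonneg_right (Real.exp_le_exp.2 ?_) (stepHeight_pos _).le
        rw [pow_succ]
        nlinarith

lemma not_memDK1_of_forall_pow {F : Measure ℝ}
    (h : ∀ k : ℕ, ∃ C : ℝ, ∀ x, 1 ≤ x → tail F x * x ^ k ≤ C) : ¬ MemDK1 F := by
  rintro ⟨δ, -, ht⟩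
  obtain ⟨k, hk⟩ := exists_nat_ge δ
  obtain ⟨C, hC⟩ := h k
  obtain ⟨x, hx1, hx2⟩ := ((ht.eventually (eventually_gt_atTop C)).and
    (eventually_ge_atTop 1)).exists
  refine absurd hx1 (not_lt.2 ((hC x hx2).trans' ?_))
  rw [mul_comm]
  refine mul_le_mul_of_nonneg_left ?_ ENNReal.toReal_nonneg
  exact_mod_cast Real.rpow_le_rpow_of_exponent_le hx2 hk

lemma exists_eventually_le_of_limsup_lt_top {F G : Measure ℝ} [IsFiniteMeasure F]
    (hG : ∀ x, G (Ioi x) ≠ 0) (hG' : ∀ x, G (Ioi x) ≠ ⊤) {r : ℝ → ℝ}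
    (h : atTop.limsup (fun x : ℝ => F (Ioi (r x)) / G (Ioi x)) < ⊤) :
    ∃ M : ℝ, 0 < M ∧ ∀ᶠ x in atTop, tail F (r x) ≤ M * tail G x := by
  obtain ⟨M, hM1, hM2⟩ := exists_between h
  have hMpos : 0 < M := (zero_le).trans_lt hM1
  refine ⟨M.toReal, ENNReal.toReal_pos hMpos.ne' hM2.ne, ?_⟩
  filter_upwards [eventually_lt_of_limsup_lt hM1] with x hx
  rw [ENNReal.div_lt_iff (Or.inl (hG x)) (Or.inl (hG' x))] at hx
  rw [tail, tail, ← ENNReal.toReal_mul]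
  exact ENNReal.toReal_mono (ENNReal.mul_ne_top hM2.ne (hG' x)) hx.le

lemma exists_eventually_le_of_liminf_pos {F G : Measure ℝ} [IsFiniteMeasure F]
    (hG : ∀ x, G (Ioi x) ≠ 0) (hG' : ∀ x, G (Ioi x) ≠ ⊤)
    (h : 0 < atTop.liminf (fun x : ℝ => F (Ioi x) / G (Ioi x))) :
    ∃ m : ℝ, 0 < m ∧ ∀ᶠ x in atTop, m * tail G x ≤ tail F x := by
  obtain ⟨m, hm1, hm2⟩ := exists_between h
  refine ⟨m.toReal, ENNReal.toReal_pos hm1.ne' hm2.ne_top, ?_⟩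
  filter_upwards [eventually_lt_of_lt_liminf hm2] with x hx
  rw [tail, tail, ← ENNReal.toReal_mul]
  refine ENNReal.toReal_mono (measure_ne_top _ _) ?_
  exact (ENNReal.le_div_iff_mul_le (Or.inl (hG x)) (Or.inl (hG' x))).1 hx.le

lemma IsDistribution.tail_pos {F : Measure ℝ} (hF : IsDistribution F) (x : ℝ) : 0 < tail F x :=
  have := hF.1
  ENNReal.toReal_pos (hF.2.2 x).ne' (measure_ne_top _ _)

/-- If `F̄(s n - t)` is arbitrarily large compared with `F̄(s n)` for large `t`, uniformly in `n`,
then so it is for every weakly tail equivalent law. -/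
lemma not_weakTailEquiv_of_memL {F G : Measure ℝ} (hF : IsDistribution F) (hG : IsDistribution G)
    (hL : MemL G) {s : ℕ → ℝ} (hs : Tendsto s atTop atTop) {c : ℝ} (hc : 0 < c)
    (h : ∀ t, 0 < t → ∀ᶠ n in atTop, t * c * tail F (s n) ≤ tail F (s n - t)) :
    ¬ WeakTailEquiv F G := by
  rintro ⟨h1, h2⟩
  have := hF.1
  have := hG.1
  have hG0 : ∀ x, G (Ioi x) ≠ 0 := fun x => (hG.2.2 x).ne'
  obtain ⟨m, hm, hm'⟩ := exists_eventually_le_of_liminf_pos hG0 (fun _ => measure_ne_top _ _) h1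
  obtain ⟨M, hM, hM'⟩ := exists_eventually_le_of_limsup_lt_top (r := fun x => x) hG0
    (fun _ => measure_ne_top _ _) h2
  set t := 2 * M / (m * c) with ht
  have ht0 : 0 < t := by positivity
  have h3 := (hL t ht0).eventually (gt_mem_nhds (one_lt_two))
  have hst : Tendsto (fun n => s n - t) atTop atTop := tendsto_atTop_add_const_right _ _ hs
  obtain ⟨n, hn1, hn2, hn3, hn4⟩ := ((h t ht0).and ((hs.eventually h3).and
    ((hs.eventually hm').and (hst.eventually hM')))).exists
  have hGn := hG.tail_pos (s n)
  rw [div_lt_iff₀ hGn] at hn2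
  have h5 : t * c * (m * tail G (s n)) ≤ M * tail G (s n - t) :=
    (mul_le_mul_of_nonneg_left hn3 (by positivity)).trans (hn1.trans hn4)
  have h6 : t * c * (m * tail G (s n)) = 2 * M * tail G (s n) := by
    rw [ht]; field_simp
  nlinarith

lemma conv2_Ioi_ge {G : Measure ℝ} (hG : IsDistribution G) {x t : ℝ} (hxt : t ≤ x) :
    tail G x * (2 - tail G t) + (tail G t - tail G x) * tail G (x - t)
      ≤ (conv2 G (Ioi x)).toReal := by
  have := hG.1
  have hIic : ∀ y, G.real (Icc 0 y) = 1 - tail G y := fun y => by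
    have h1 : G.real (Iic y) = 1 - tail G y := by
      rw [← compl_Ioi, probReal_compl_eq_one_sub measurableSet_Ioi]; rfl
    rw [← h1]
    refine measureReal_congr ?_
    have h0 : ∀ᵐ z ∂G, 0 ≤ z := by
      rw [ae_iff]; simpa [Iio] using hG.2.1
    filter_upwards [h0] with z hz
    exact propext ⟨fun h => h.2, fun h => ⟨hz, h⟩⟩
  have hIci : G.real (Ici 0) = 1 := by
    rw [← compl_Iio, probReal_compl_eq_one_sub measurableSet_Iio]
    simp [measureReal_def, hG.2.1]
  have hIoc : G.real (Ioc t x) = tail G t - tail G x := by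
    have h1 : G.real (Ioi t) = G.real (Ioc t x) + G.real (Ioi x) := by
      rw [← Ioc_union_Ioi_eq_Ioi hxt]
      exact measureReal_union (Set.disjoint_left.2 fun z hz hz' => not_lt.2 hz.2 hz')
        measurableSet_Ioi
    simp only [measureReal_def] at h1
    simp only [measureReal_def, tail]
    linarith
  have hsub : (Ioi x ×ˢ Ici 0) ∪ ((Icc 0 t ×ˢ Ioi x) ∪ (Ioc t x ×ˢ Ioi (x - t)))
      ⊆ (fun p : ℝ × ℝ => p.1 + p.2) ⁻¹' Ioi x := by
    rintro ⟨a, b⟩ (⟨h1, h2⟩ | ⟨h1, h2⟩ | ⟨h1, h2⟩) <;>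
      simp only [mem_Ioi, mem_Ici, mem_Icc, mem_Ioc, mem_preimage] at * <;> linarith [h1]
  have hle := measureReal_mono (μ := G.prod G) hsub
  rw [measureReal_union _ ((measurableSet_Icc.prod measurableSet_Ioi).union
      (measurableSet_Ioc.prod measurableSet_Ioi)),
    measureReal_union _ (measurableSet_Ioc.prod measurableSet_Ioi), measureReal_prod_prod,
    measureReal_prod_prod, measureReal_prod_prod, hIci, hIic, hIoc] at hle
  · rw [conv2, Measure.map_apply (by fun_prop) measurableSet_Ioi]
    simp only [measureReal_def] at hle
    simp only [tail] at hle ⊢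
    linarith
  · rw [Set.disjoint_left]
    rintro ⟨a, b⟩ ⟨h1, h2⟩ ⟨h3, h4⟩
    exact not_lt.2 h1.2 h3.1
  · rw [Set.disjoint_left]
    rintro ⟨a, b⟩ ⟨h1, h2⟩ (⟨h3, h4⟩ | ⟨h3, h4⟩)
    · exact not_lt.2 (h3.2.trans hxt) h1
    · exact not_lt.2 h3.2 h1

lemma tail_antitone (G : Measure ℝ) [IsFiniteMeasure G] : Antitone (tail G) := fun _ _ h =>
  ENNReal.toReal_mono (measure_ne_top _ _) (measure_mono (Ioi_subset_Ioi h))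

lemma tail_tendsto_zero (G : Measure ℝ) [IsFiniteMeasure G] : Tendsto (tail G) atTop (𝓝 0) := by
  have h : Tendsto (fun x : ℝ => G (Ioi x)) atTop (𝓝 (G (⋂ x : ℝ, Ioi x))) :=
    tendsto_measure_iInter_atTop (fun _ => measurableSet_Ioi.nullMeasurableSet)
      (fun _ _ h => Ioi_subset_Ioi h) ⟨0, measure_ne_top _ _⟩
  have h2 : (⋂ x : ℝ, Ioi x) = ∅ :=
    eq_empty_of_forall_notMem fun x hx => lt_irrefl x (mem_iInter.1 hx x)
  rw [h2, measure_empty] at h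
  exact (ENNReal.tendsto_toReal ENNReal.zero_ne_top).comp h

/-- Subexponential laws are long-tailed. -/
lemma MemS.memL {G : Measure ℝ} (hG : IsDistribution G) (hS : MemS G) : MemL G := by
  intro t ht
  have := hG.1
  have ht0 := hG.tail_pos t
  have hlim : Tendsto (fun x => ((conv2 G (Ioi x)).toReal / tail G x - (2 - tail G t))
      / (tail G t - tail G x)) atTop (𝓝 1) := by
    have h := (Tendsto.sub_const hS (2 - tail G t)).div
      ((tail_tendsto_zero G).const_sub (tail G t)) (by simpa using ht0.ne')
    simpa [div_self ht0.ne', Pi.div_def] using h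
  refine tendsto_of_tendsto_of_tendsto_of_le_of_le' tendsto_const_nhds hlim ?_ ?_
  · refine Eventually.of_forall fun x => ?_
    rw [one_le_div (hG.tail_pos x)]
    exact tail_antitone G (by linarith)
  · filter_upwards [eventually_ge_atTop t,
      (tail_tendsto_zero G).eventually (gt_mem_nhds ht0)] with x hx hx2
    have hxp := hG.tail_pos x
    rw [le_div_iff₀ (sub_pos.2 hx2), le_sub_iff_add_le, le_div_iff₀ hxp]
    refine (conv2_Ioi_ge hG hx).trans_eq' ?_
    field_simp
    ring

/-- A growth condition on the tail that implies the principle of a single big jump. -/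
lemma memJ_of_growth {q : Measure ℝ} (hq : IsDistribution q) {g : ℝ → ENNReal}
    (hg : MonotoneOn g (Ici 0))
    (hInt : Tendsto (fun K : ℝ => ∫⁻ y in Ioi K, g y ∂q) atTop (𝓝 0))
    (hgrow : ∀ᶠ x in atTop, ∀ y, 0 ≤ y → y ≤ x / 2 → q (Ioi (x - y)) ≤ g y * q (Ioi x)) :
    MemJ q := by
  have := hq.1
  have hmeas : ∀ x : ℝ, MeasurableSet {p : ℝ × ℝ | x < p.1 + p.2} := fun x =>
    measurableSet_lt measurable_const (measurable_fst.add measurable_snd)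
  have hsum : ∀ x, q (Ioi x) ≤ q.prod q {p : ℝ × ℝ | x < p.1 + p.2} := fun x => by
    have h1 : q (Ici 0) = 1 := by
      rw [← compl_Iio]
      exact (prob_compl_eq_one_iff measurableSet_Iio).2 hq.2.1
    calc q (Ioi x) = q.prod q (Ioi x ×ˢ Ici 0) := by rw [Measure.prod_prod, h1, mul_one]
      _ ≤ _ := measure_mono fun p hp => by
        have h2 := hp.1
        have h3 := hp.2
        simp only [mem_Ioi, mem_Ici, mem_ofPred_eq] at *
        linarith
  have hbig : ∀ ε : ENNReal, 0 < ε → ∀ᶠ K : ℝ in atTop, ∀ᶠ x : ℝ in atTop,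
      q.prod q {p : ℝ × ℝ | (K < p.1 ∧ K < p.2) ∧ x < p.1 + p.2}
        ≤ (ε + ε + ε) * q (Ioi x) := by
    intro ε hε
    have hεev : ∀ᶠ K : ℝ in atTop, ∫⁻ y in Ioi K, g y ∂q < ε := hInt.eventually (gt_mem_nhds hε)
    filter_upwards [eventually_ge_atTop 0, hεev] with K hK hKε
    have hhalf : Tendsto (fun x : ℝ => x / 2) atTop atTop :=
      tendsto_id.atTop_div_const (by norm_num)
    filter_upwards [hgrow, hhalf.eventually hεev, eventually_ge_atTop 0] with x hx hxε hx0
    set A : Set (ℝ × ℝ) := {p | (K < p.1 ∧ p.1 ≤ x / 2) ∧ x < p.1 + p.2} with hA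
    have hAm : MeasurableSet A :=
      ((measurableSet_lt measurable_const measurable_fst).inter
        (measurableSet_le measurable_fst measurable_const)).inter (hmeas x)
    have hAle : q.prod q A ≤ ε * q (Ioi x) := by
      rw [Measure.prod_apply hAm]
      calc ∫⁻ y, q (Prod.mk y ⁻¹' A) ∂q
          ≤ ∫⁻ y, (Ioi K).indicator (fun y => g y * q (Ioi x)) y ∂q := by
            refine lintegral_mono fun y => ?_
            by_cases hy : K < y ∧ y ≤ x / 2
            · rw [indicator_of_mem (show y ∈ Ioi K from hy.1)]
              refine (hx y (hK.trans hy.1.le) hy.2).trans' (measure_mono fun z hz => ?_)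
              have hz' : x < y + z := hz.2
              simp only [mem_Ioi]
              linarith
            · have : Prod.mk y ⁻¹' A = ∅ := eq_empty_of_forall_notMem fun z hz => hy hz.1
              simp [this]
        _ = (∫⁻ y in Ioi K, g y ∂q) * q (Ioi x) := by
            rw [lintegral_indicator measurableSet_Ioi,
              lintegral_mul_const' _ _ (measure_ne_top _ _)]
        _ ≤ ε * q (Ioi x) := mul_le_mul_left hKε.le _
    have hswap : q.prod q (Prod.swap ⁻¹' A) = q.prod q A := by
      conv_rhs => rw [← Measure.prod_swap, Measure.map_apply measurable_swap hAm]
    have hsq : q.prod q (Ioi (x / 2) ×ˢ Ioi (x / 2)) ≤ ε * q (Ioi x) := by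
      rw [Measure.prod_prod]
      have h1 : q (Ioi (x / 2)) ≤ g (x / 2) * q (Ioi x) := by
        simpa [sub_half] using hx (x / 2) (by linarith) le_rfl
      have h2 : g (x / 2) * q (Ioi (x / 2)) ≤ ε := by
        refine hxε.le.trans' ?_
        rw [← setLIntegral_const]
        refine setLIntegral_mono' measurableSet_Ioi fun y hy => ?_
        have hy' : x / 2 < y := hy
        exact hg (by simp only [mem_Ici]; linarith) (by simp only [mem_Ici]; linarith) hy'.le
      calc q (Ioi (x / 2)) * q (Ioi (x / 2))
          ≤ q (Ioi (x / 2)) * (g (x / 2) * q (Ioi x)) := mul_le_mul_right h1 _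
        _ = g (x / 2) * q (Ioi (x / 2)) * q (Ioi x) := by ring
        _ ≤ ε * q (Ioi x) := mul_le_mul_left h2 _
    calc q.prod q {p : ℝ × ℝ | (K < p.1 ∧ K < p.2) ∧ x < p.1 + p.2}
        ≤ q.prod q (A ∪ Prod.swap ⁻¹' A ∪ Ioi (x / 2) ×ˢ Ioi (x / 2)) := by
          refine measure_mono ?_
          rintro ⟨a, b⟩ ⟨⟨h1, h2⟩, h3⟩
          simp only [hA, mem_union, mem_ofPred_eq, mem_preimage, Prod.swap, mem_prod, mem_Ioi] at *
          by_cases ha : a ≤ x / 2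
          · exact Or.inl (Or.inl ⟨⟨h1, ha⟩, h3⟩)
          · by_cases hb : b ≤ x / 2
            · exact Or.inl (Or.inr ⟨⟨h2, hb⟩, by linarith⟩)
            · exact Or.inr ⟨not_le.1 ha, not_le.1 hb⟩
      _ ≤ q.prod q A + q.prod q A + q.prod q (Ioi (x / 2) ×ˢ Ioi (x / 2)) := by
          refine (measure_union_le _ _).trans (add_le_add_left ?_ _)
          exact (measure_union_le _ _).trans_eq (by rw [hswap])
      _ ≤ ε * q (Ioi x) + ε * q (Ioi x) + ε * q (Ioi x) := by gcongr
      _ = (ε + ε + ε) * q (Ioi x) := by ring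
  have hle1 : ∀ K x : ℝ, ((q.prod q) {p : ℝ × ℝ | min p.1 p.2 ≤ K ∧ x < p.1 + p.2}).toReal /
      ((q.prod q) {p : ℝ × ℝ | x < p.1 + p.2}).toReal ≤ 1 := fun K x =>
    div_le_one_of_le₀ (ENNReal.toReal_mono (measure_ne_top _ _) (measure_mono fun p hp => hp.2))
      ENNReal.toReal_nonneg
  have h0le : ∀ K x : ℝ, 0 ≤ ((q.prod q) {p : ℝ × ℝ | min p.1 p.2 ≤ K ∧ x < p.1 + p.2}).toReal /
      ((q.prod q) {p : ℝ × ℝ | x < p.1 + p.2}).toReal := fun K x => by positivity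
  rw [MemJ, tendsto_order]
  constructor
  · intro b hb
    set ε : ℝ := (1 - b) / 6 with hε
    have hεpos : 0 < ε := by rw [hε]; linarith
    filter_upwards [hbig (ENNReal.ofReal ε) (ENNReal.ofReal_pos.2 hεpos)] with K hK
    refine (show b < 1 - 3 * ε by rw [hε]; linarith).trans_le ?_
    refine le_liminf_of_le (isBoundedUnder_of ⟨1, hle1 K⟩).isCoboundedUnder_ge ?_
    filter_upwards [hK] with x hx
    set D := (q.prod q) {p : ℝ × ℝ | x < p.1 + p.2} with hD
    have hDpos : 0 < D := (hq.2.2 x).trans_le (hsum x)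
    have hDr : 0 < D.toReal := ENNReal.toReal_pos hDpos.ne' (measure_ne_top _ _)
    rw [le_div_iff₀ hDr]
    have hsplit : D.toReal ≤
        ((q.prod q) {p : ℝ × ℝ | min p.1 p.2 ≤ K ∧ x < p.1 + p.2}).toReal +
        ((q.prod q) {p : ℝ × ℝ | (K < p.1 ∧ K < p.2) ∧ x < p.1 + p.2}).toReal := by
      rw [← ENNReal.toReal_add (measure_ne_top _ _) (measure_ne_top _ _)]
      refine ENNReal.toReal_mono (by finiteness)
        ((measure_mono fun p hp => ?_).trans (measure_union_le _ _))
      by_cases h : min p.1 p.2 ≤ K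
      · exact Or.inl ⟨h, hp⟩
      · exact Or.inr ⟨lt_min_iff.1 (not_le.1 h), hp⟩
    have h3 : ((q.prod q) {p : ℝ × ℝ | (K < p.1 ∧ K < p.2) ∧ x < p.1 + p.2}).toReal
        ≤ 3 * ε * D.toReal := by
      have h4 := ENNReal.toReal_mono (by finiteness) (hx.trans (mul_le_mul_right (hsum x) _))
      rw [ENNReal.toReal_mul, ← hD, ← ENNReal.ofReal_add hεpos.le hεpos.le,
        ← ENNReal.ofReal_add (by linarith) hεpos.le, ENNReal.toReal_ofReal (by linarith)] at h4
      linarith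
    linarith
  · intro b hb
    refine Eventually.of_forall fun K => lt_of_le_of_lt ?_ hb
    refine liminf_le_of_le (isBoundedUnder_of ⟨0, h0le K⟩) fun c hc => ?_
    obtain ⟨x, hx⟩ := hc.exists
    exact hx.trans (hle1 K x)

lemma tendsto_two_pow_succ : Tendsto (fun n : ℕ => (2 : ℝ) ^ (n + 1)) atTop atTop :=
  (tendsto_pow_atTop_atTop_of_one_lt one_lt_two).comp (tendsto_add_atTop_nat 1)

lemma stepLaw_not_memOL : ¬ MemOL stepLaw := by
  intro h
  have := stepLaw_isDistribution.1
  obtain ⟨M, -, hM⟩ := exists_eventually_le_of_limsup_lt_top (r := fun x => x - 1)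
    (fun x => (stepLaw_isDistribution.2.2 x).ne') (fun _ => measure_ne_top _ _) (h 1 one_pos)
  obtain ⟨n, hn1, hn2⟩ := ((tendsto_two_pow_succ.eventually hM).and
    (tendsto_two_pow_succ.eventually (eventually_gt_atTop M))).exists
  rw [tail_stepLaw, tail_stepLaw, stepTail_two_pow,
    stepTail_two_pow_sub one_pos (one_le_pow₀ one_le_two), ← stepHeight_succ_mul (n + 1)] at hn1
  nlinarith [stepHeight_pos (n + 1 + 1)]

lemma stepLaw_not_memJ : ¬ MemJ stepLaw := by
  intro h
  have := stepLaw_isDistribution.1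
  refine absurd (le_of_tendsto h (b := 0) ?_) (not_le.2 one_pos)
  filter_upwards [eventually_ge_atTop 0] with K hK
  have h0le : ∀ x : ℝ, 0 ≤
      ((stepLaw.prod stepLaw) {p : ℝ × ℝ | min p.1 p.2 ≤ K ∧ x < p.1 + p.2}).toReal /
      ((stepLaw.prod stepLaw) {p : ℝ × ℝ | x < p.1 + p.2}).toReal := fun x => by positivity
  refine liminf_le_of_le (isBoundedUnder_of ⟨0, h0le⟩) fun c hc => ?_
  have hx : Tendsto (fun n : ℕ => (2 : ℝ) ^ (n + 1) + K) atTop atTop :=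
    tendsto_atTop_add_const_right _ _ tendsto_two_pow_succ
  have hd := stepTail_pos (K + 1)
  have hlim : Tendsto (fun n : ℕ => 2 / stepTail (K + 1) / (2 : ℝ) ^ (n + 1)) atTop (𝓝 0) :=
    tendsto_const_nhds.div_atTop tendsto_two_pow_succ
  refine ge_of_tendsto hlim ?_
  filter_upwards [hx.eventually hc] with n hn
  refine hn.trans ?_
  have hnum : ((stepLaw.prod stepLaw)
      {p : ℝ × ℝ | min p.1 p.2 ≤ K ∧ 2 ^ (n + 1) + K < p.1 + p.2}).toReal
      ≤ 2 * stepHeight (n + 1 + 1) := by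
    calc ((stepLaw.prod stepLaw)
          {p : ℝ × ℝ | min p.1 p.2 ≤ K ∧ 2 ^ (n + 1) + K < p.1 + p.2}).toReal
        ≤ (stepLaw.prod stepLaw).real
            ((Ioi (2 ^ (n + 1)) ×ˢ univ) ∪ (univ ×ˢ Ioi (2 ^ (n + 1)))) := by
          refine measureReal_mono (μ := stepLaw.prod stepLaw) ?_
          rintro ⟨a, b⟩ ⟨h1, h2⟩
          simp only [min_le_iff, mem_union, mem_prod, mem_Ioi, mem_univ, and_true,
            true_and] at *
          rcases h1 with h1 | h1
          · right; linarith
          · left; linarith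
      _ ≤ tail stepLaw (2 ^ (n + 1)) + tail stepLaw (2 ^ (n + 1)) := by
          refine (measureReal_union_le _ _).trans_eq ?_
          rw [measureReal_prod_prod, measureReal_prod_prod]
          simp [tail, measureReal_def]
      _ = 2 * stepHeight (n + 1 + 1) := by rw [tail_stepLaw, stepTail_two_pow]; ring
  have hden : stepHeight (n + 1) * stepTail (K + 1) ≤
      ((stepLaw.prod stepLaw) {p : ℝ × ℝ | 2 ^ (n + 1) + K < p.1 + p.2}).toReal := by
    rw [← stepTail_two_pow_sub (n := n) one_pos (one_le_pow₀ one_le_two), ← tail_stepLaw,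
      ← tail_stepLaw]
    refine (measureReal_prod_prod (μ := stepLaw) (ν := stepLaw) (Ioi ((2 : ℝ) ^ (n + 1) - 1))
      (Ioi (K + 1))).symm.le.trans (measureReal_mono (μ := stepLaw.prod stepLaw) ?_)
    rintro ⟨a, b⟩ ⟨h1, h2⟩
    simp only [mem_Ioi, mem_ofPred_eq] at *
    linarith
  have hwpos := stepHeight_pos (n + 1)
  calc _ ≤ 2 * stepHeight (n + 1 + 1) / (stepHeight (n + 1) * stepTail (K + 1)) :=
        div_le_div₀ (by have := stepHeight_pos (n + 1 + 1); positivity) hnum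
          (by positivity) hden
    _ = 2 / stepTail (K + 1) / (2 : ℝ) ^ (n + 1) := by
        rw [← stepHeight_succ_mul (n + 1)]
        have := stepHeight_pos (n + 1 + 1)
        field_simp

/-- The integrated tail distribution of `stepLaw`. -/
def stepIntLaw : Measure ℝ :=
  (∫⁻ y in Ioi (0 : ℝ), ENNReal.ofReal (stepTail y))⁻¹ •
    (volume.restrict (Ioi 0)).withDensity fun y => ENNReal.ofReal (stepTail y)

lemma stepIntLaw_Ioi_eq_div {z : ℝ} (hz : 0 ≤ z) : stepIntLaw (Ioi z) =
    (∫⁻ y in Ioi z, ENNReal.ofReal (stepTail y)) /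
      ∫⁻ y in Ioi (0 : ℝ), ENNReal.ofReal (stepTail y) := by
  rw [stepIntLaw, Measure.smul_apply, withDensity_apply _ measurableSet_Ioi,
    Measure.restrict_restrict measurableSet_Ioi, inter_eq_left.2 (Ioi_subset_Ioi hz), smul_eq_mul,
    ENNReal.div_eq_inv_mul]

lemma stepIntLaw_Ioi {z : ℝ} (hz : 0 ≤ z) :
    stepIntLaw (Ioi z) = ENNReal.ofReal (intTail z / intTail 0) := by
  rw [stepIntLaw_Ioi_eq_div hz, setLIntegral_stepTail hz, setLIntegral_stepTail le_rfl,
    ENNReal.ofReal_div_of_pos (intTail_pos le_rfl)]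

lemma tail_stepIntLaw {z : ℝ} (hz : 0 ≤ z) : tail stepIntLaw z = intTail z / intTail 0 := by
  rw [tail, stepIntLaw_Ioi hz,
    ENNReal.toReal_ofReal (div_nonneg (intTail_nonneg z) (intTail_nonneg 0))]

lemma stepIntLaw_isDistribution : IsDistribution stepIntLaw := by
  refine ⟨⟨?_⟩, ?_, fun x => ?_⟩
  · rw [stepIntLaw, Measure.smul_apply, withDensity_apply _ MeasurableSet.univ,
      Measure.restrict_univ, smul_eq_mul, setLIntegral_stepTail le_rfl]
    exact ENNReal.inv_mul_cancel (ENNReal.ofReal_pos.2 (intTail_pos le_rfl)).ne'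
      ENNReal.ofReal_ne_top
  · rw [stepIntLaw, Measure.smul_apply, withDensity_apply _ measurableSet_Iio,
      Measure.restrict_restrict measurableSet_Iio,
      eq_empty_of_forall_notMem fun z (hz : z ∈ Iio (0 : ℝ) ∩ Ioi 0) =>
        lt_asymm (mem_Iio.1 hz.1) (mem_Ioi.1 hz.2)]
    simp
  · have h : stepIntLaw (Ioi (max x 0)) ≤ stepIntLaw (Ioi x) :=
      measure_mono (Ioi_subset_Ioi (le_max_left _ _))
    refine h.trans_lt' ?_
    rw [stepIntLaw_Ioi (le_max_right _ _), ENNReal.ofReal_pos]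
    exact div_pos (intTail_pos (le_max_right _ _)) (intTail_pos le_rfl)

lemma stepIntLaw_memJ : MemJ stepIntLaw := by
  obtain ⟨C, hC, hT⟩ := stepTail_mul_pow_le 4
  refine memJ_of_growth stepIntLaw_isDistribution
    (g := fun y => ENNReal.ofReal (4 * (1 + y) ^ 2)) ?_ ?_ ?_
  · intro a ha b hb hab
    have ha' : 0 ≤ a := ha
    dsimp only
    gcongr
  · set c := (∫⁻ y in Ioi (0 : ℝ), ENNReal.ofReal (stepTail y))⁻¹ with hc
    have hc_top : c ≠ ⊤ := by
      rw [hc, setLIntegral_stepTail le_rfl]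
      exact ENNReal.inv_ne_top.2 (ENNReal.ofReal_pos.2 (intTail_pos le_rfl)).ne'
    have hlim : Tendsto (fun K : ℝ => c * ENNReal.ofReal (16 * C / K)) atTop (𝓝 0) := by
      have h1 : Tendsto (fun K : ℝ => ENNReal.ofReal (16 * C / K)) atTop (𝓝 0) := by
        simpa using ENNReal.tendsto_ofReal
          (tendsto_const_nhds.div_atTop tendsto_id : Tendsto (fun K : ℝ => 16 * C / K) atTop (𝓝 0))
      simpa using ENNReal.Tendsto.const_mul h1 (Or.inr hc_top)
    refine tendsto_of_tendsto_of_tendsto_of_le_of_le' tendsto_const_nhds hlim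
      (Eventually.of_forall fun _ => zero_le) ?_
    filter_upwards [eventually_ge_atTop 1] with K hK
    have hmeas : Measurable fun y => ENNReal.ofReal (stepTail y) :=
      stepTail_antitone.measurable.ennreal_ofReal
    rw [stepIntLaw, Measure.restrict_smul, lintegral_smul_measure, ← hc, smul_eq_mul,
      setLIntegral_withDensity_eq_setLIntegral_mul _ hmeas (by fun_prop) measurableSet_Ioi,
      Measure.restrict_restrict measurableSet_Ioi,
      inter_eq_left.2 (Ioi_subset_Ioi (by linarith)),
      ← setLIntegral_Ioi_const_div_sq (by linarith) (by linarith)]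
    refine mul_le_mul_right (setLIntegral_mono' measurableSet_Ioi fun y hy => ?_) _
    have hy1 : 1 < y := hK.trans_lt hy
    have hTpos := stepTail_pos y
    rw [Pi.mul_apply, ← ENNReal.ofReal_mul hTpos.le]
    refine ENNReal.ofReal_le_ofReal ?_
    rw [le_div_iff₀ (by positivity)]
    calc stepTail y * (4 * (1 + y) ^ 2) * y ^ 2
        ≤ stepTail y * (4 * (y + y) ^ 2) * y ^ 2 := by gcongr
      _ = 16 * (stepTail y * y ^ 4) := by ring
      _ ≤ 16 * C := by linarith [hT y (by linarith)]
  · filter_upwards [eventually_ge_atTop 2] with x hx y hy hyx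
    have h0 := intTail_pos le_rfl
    rw [stepIntLaw_Ioi (by linarith), stepIntLaw_Ioi (by linarith),
      ← ENNReal.ofReal_mul (by positivity)]
    refine ENNReal.ofReal_le_ofReal ?_
    rw [← mul_div_assoc]
    exact div_le_div_of_nonneg_right (intTail_sub_le hx hy hyx) h0.le

lemma le_tail_stepIntLaw_two_pow_sub {n : ℕ} {t : ℝ} (ht : 0 ≤ t) (htn : t ≤ 2 ^ n) :
    t * (1 / 4) * tail stepIntLaw (2 ^ (n + 1)) ≤ tail stepIntLaw (2 ^ (n + 1) - t) := by
  have h2 : (0 : ℝ) ≤ 2 ^ (n + 1) - t := by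
    rw [pow_succ]; linarith [(by positivity : (0 : ℝ) ≤ 2 ^ n)]
  rw [tail_stepIntLaw (by positivity), tail_stepIntLaw h2, ← mul_div_assoc, mul_one_div]
  exact div_le_div_of_nonneg_right (le_intTail_two_pow_sub ht htn) (intTail_nonneg 0)

lemma eventually_le_tail_stepIntLaw {t : ℝ} (ht : 0 < t) : ∀ᶠ n : ℕ in atTop,
    t * (1 / 4) * tail stepIntLaw (2 ^ (n + 1)) ≤ tail stepIntLaw (2 ^ (n + 1) - t) := by
  filter_upwards [(tendsto_pow_atTop_atTop_of_one_lt (one_lt_two (α := ℝ))).eventually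
    (eventually_ge_atTop t)] with n hn
  exact le_tail_stepIntLaw_two_pow_sub ht.le hn

lemma stepIntLaw_not_weakTailEquiv_memL {G : Measure ℝ} (hG : IsDistribution G) (hL : MemL G) :
    ¬ WeakTailEquiv stepIntLaw G :=
  not_weakTailEquiv_of_memL stepIntLaw_isDistribution hG hL tendsto_two_pow_succ
    (by norm_num) fun _ => eventually_le_tail_stepIntLaw

lemma stepIntLaw_not_memL : ¬ MemL stepIntLaw := by
  intro h
  have h1 := (h 8 (by norm_num)).eventually (gt_mem_nhds one_lt_two)
  obtain ⟨n, hn1, hn2⟩ := ((tendsto_two_pow_succ.eventually h1).and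
    (eventually_le_tail_stepIntLaw (t := 8) (by norm_num))).exists
  rw [div_lt_iff₀ (stepIntLaw_isDistribution.tail_pos _)] at hn1
  linarith

lemma stepIntLaw_not_memD : ¬ MemD stepIntLaw := by
  intro h
  have := stepIntLaw_isDistribution.1
  obtain ⟨M, -, hM⟩ := exists_eventually_le_of_limsup_lt_top (r := fun x => x / 2)
    (fun x => (stepIntLaw_isDistribution.2.2 x).ne') (fun _ => measure_ne_top _ _) h
  obtain ⟨n, hn1, hn2⟩ := ((tendsto_two_pow_succ.eventually hM).and
    (tendsto_two_pow_succ.eventually (eventually_gt_atTop (8 * M)))).exists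
  have h1 := le_tail_stepIntLaw_two_pow_sub (n := n) (t := 2 ^ n) (by positivity) le_rfl
  have h2 : (2 : ℝ) ^ (n + 1) = 2 ^ n * 2 := pow_succ _ _
  rw [show (2 : ℝ) ^ (n + 1) - 2 ^ n = 2 ^ (n + 1) / 2 by rw [h2]; ring] at h1
  nlinarith [stepIntLaw_isDistribution.tail_pos (2 ^ (n + 1))]

lemma stepLaw_stronglyHeavyTailed : StronglyHeavyTailed stepLaw := fun _ hl => by
  simpa only [tail_stepLaw] using exp_mul_stepTail_tendsto hl

lemma stepIntLaw_stronglyHeavyTailed : StronglyHeavyTailed stepIntLaw := fun l hl => by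
  refine tendsto_atTop_mono' _ ?_
    ((exp_mul_stepTail_tendsto hl).atTop_div_const (intTail_pos le_rfl))
  filter_upwards [eventually_ge_atTop 0] with x hx
  rw [tail_stepIntLaw hx, ← mul_div_assoc]
  exact div_le_div_of_nonneg_right (mul_le_mul_of_nonneg_left (stepTail_le_intTail hx)
    (Real.exp_pos _).le) (intTail_nonneg 0)

lemma stepLaw_not_memDK1 : ¬ MemDK1 stepLaw := not_memDK1_of_forall_pow fun k => by
  obtain ⟨C, -, hC⟩ := stepTail_mul_pow_le k
  exact ⟨C, fun x hx => by rw [tail_stepLaw]; exact hC x (by linarith)⟩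

lemma stepIntLaw_not_memDK1 : ¬ MemDK1 stepIntLaw := not_memDK1_of_forall_pow fun k => by
  obtain ⟨C, -, hC⟩ := intTail_mul_pow_le k
  refine ⟨C / intTail 0, fun x hx => ?_⟩
  rw [tail_stepIntLaw (by linarith), div_mul_eq_mul_div]
  exact div_le_div_of_nonneg_right (hC x hx) (intTail_nonneg 0)

/-- Proposition 1.1: there is a distribution `F` with finite positive mean
`μ = ∫₀^∞ F̄` such that `F ∈ 𝒟𝒦ᶜ` but `F ∉ 𝒪ℒ` (hence `F ∉ 𝒥`) and `F ∉ 𝒟𝒦₁`, while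
the integrated tail distribution `F^I` (with tail `μ⁻¹ ∫_x^∞ F̄`) satisfies `F^I ∈ 𝒥`,
`F^I ∈ 𝒟𝒦ᶜ`, `F^I ∉ 𝒟𝒦₁`, `F^I ∉ ℒ`, `F^I ∉ 𝒟`, and `F^I` is not weakly tail
equivalent to any subexponential distribution. -/
theorem exists_integratedTail_in_J_minus_S :
    ∃ F : Measure ℝ, IsDistribution F ∧
      0 < (∫⁻ y in Set.Ioi (0 : ℝ), F (Set.Ioi y) ∂volume) ∧
      (∫⁻ y in Set.Ioi (0 : ℝ), F (Set.Ioi y) ∂volume) < ⊤ ∧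
      StronglyHeavyTailed F ∧ ¬ MemOL F ∧ ¬ MemJ F ∧ ¬ MemDK1 F ∧
      ∃ FI : Measure ℝ, IsDistribution FI ∧
        (∀ z : ℝ, 0 ≤ z → FI (Set.Ioi z) =
          (∫⁻ y in Set.Ioi z, F (Set.Ioi y) ∂volume) /
          (∫⁻ y in Set.Ioi (0 : ℝ), F (Set.Ioi y) ∂volume)) ∧
        MemJ FI ∧ StronglyHeavyTailed FI ∧ ¬ MemDK1 FI ∧ ¬ MemL FI ∧ ¬ MemD FI ∧
        ¬ ∃ G : Measure ℝ, IsDistribution G ∧ MemS G ∧ WeakTailEquiv FI G := by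
  have hlaw : (fun y : ℝ => stepLaw (Ioi y)) = fun y => ENNReal.ofReal (stepTail y) :=
    funext stepLaw_Ioi
  refine ⟨stepLaw, stepLaw_isDistribution, ?_, ?_, stepLaw_stronglyHeavyTailed,
    stepLaw_not_memOL, stepLaw_not_memJ, stepLaw_not_memDK1, stepIntLaw,
    stepIntLaw_isDistribution, fun z hz => ?_, stepIntLaw_memJ, stepIntLaw_stronglyHeavyTailed,
    stepIntLaw_not_memDK1, stepIntLaw_not_memL, stepIntLaw_not_memD, ?_⟩
  · rw [hlaw, setLIntegral_stepTail le_rfl]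
    exact ENNReal.ofReal_pos.2 (intTail_pos le_rfl)
  · rw [hlaw]
    exact setLIntegral_stepTail_zero_lt_top
  · rw [hlaw]
    exact stepIntLaw_Ioi_eq_div hz
  · rintro ⟨G, hG, hS, hW⟩
    exact stepIntLaw_not_weakTailEquiv_memL hG (hS.memL hG) hW
end
end

section
/- Let F be the distribution on [0,∞) with tail F̄(x) = 1/8 for 0 ≤ x < 4 and F̄(x) = 2^{(−n−n²)/2} − 2^{(−3n−n²)/2} for 2^n ≤ x < 2^{n+1}, n ≥ 2. Then: (i) F̄(2^n − 1)/F̄(2^n) → ∞ as n → ∞, so F ∉ 𝒪ℒ; (ii) F has mean μ = ∫₀^∞ F̄(y) dy = 1; and (iii) the integrated tail distribution F^I has tail F̄^I(x) = 1 − x/8 for 0 ≤ x < 4 and F̄^I(x) = 2^{(n−n²)/2} + (2^{(−3n−n²)/2} − 2^{(−n−n²)/2})(x − 2^n) for 2^n ≤ x < 2^{n+1}, n ≥ 2. -/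
open MeasureTheory Filter Set Topology

noncomputable section

theorem setLIntegral_Ico_of_eqOn_const {f : ℝ → ENNReal} {a b c : ℝ} (hc : 0 ≤ c)
    (hf : ∀ y, a ≤ y → y < b → f y = ENNReal.ofReal c) :
    ∫⁻ y in Ico a b, f y = ENNReal.ofReal (c * (b - a)) := by
  rw [setLIntegral_congr_fun (g := fun _ => ENNReal.ofReal c) measurableSet_Ico
    (fun y hy => hf y hy.1 hy.2), setLIntegral_const, Real.volume_Ico, ENNReal.ofReal_mul hc]

theorem setLIntegral_Ici_eq_add {f : ℝ → ENNReal} {a b : ℝ} (hab : a ≤ b) :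
    ∫⁻ y in Ici a, f y = (∫⁻ y in Ico a b, f y) + ∫⁻ y in Ici b, f y := by
  rw [← lintegral_union measurableSet_Ici, Ico_union_Ici_eq_Ici hab]
  rw [Set.disjoint_left]
  exact fun x hx hx' => absurd hx.2 (not_lt.2 hx')

/-- If the integrals of `f` over consecutive intervals `[b k, b (k+1))` telescope along a
sequence `w` decreasing to zero, then the integral over `[b 0, ∞)` is `w 0`. -/
theorem setLIntegral_Ici_of_telescoping {f : ℝ → ENNReal} {b w : ℕ → ℝ} (hb : Monotone b)
    (hb' : Tendsto b atTop atTop) (hw : Antitone w) (hw' : Tendsto w atTop (𝓝 0))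
    (hf : ∀ k, ∫⁻ y in Ico (b k) (b (k + 1)), f y = ENNReal.ofReal (w k - w (k + 1))) :
    ∫⁻ y in Ici (b 0), f y = ENNReal.ofReal (w 0) := by
  have hpart : ∀ k, ∫⁻ y in Ico (b 0) (b k), f y = ENNReal.ofReal (w 0 - w k) := by
    intro k
    induction k with
    | zero => simp
    | succ k ih =>
      have hdisj : Disjoint (Ico (b 0) (b k)) (Ico (b k) (b (k + 1))) := by
        rw [Set.disjoint_left]
        exact fun x hx hx' => absurd hx.2 (not_lt.2 hx'.1)
      rw [← Ico_union_Ico_eq_Ico (hb (Nat.zero_le k)) (hb (Nat.le_succ k)),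
        lintegral_union measurableSet_Ico hdisj, ih, hf,
        ← ENNReal.ofReal_add (sub_nonneg.2 (hw (Nat.zero_le k)))
          (sub_nonneg.2 (hw (Nat.le_succ k)))]
      congr 1
      ring
  have hmono : Monotone fun k => Ico (b 0) (b k) :=
    fun i j hij => Ico_subset_Ico_right (hb hij)
  have hunion : ⋃ k, Ico (b 0) (b k) = Ici (b 0) := by
    ext x
    simp only [mem_iUnion, mem_Ico, mem_Ici]
    refine ⟨fun ⟨_, h⟩ => h.1, fun h => ?_⟩
    obtain ⟨k, hk⟩ := (hb'.eventually_gt_atTop x).exists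
    exact ⟨k, h, hk⟩
  rw [← hunion, setLIntegral_iUnion_of_directed f hmono.directed_le]
  have hlim := tendsto_atTop_iSup (f := fun k => ∫⁻ y in Ico (b 0) (b k), f y)
    fun i j hij => lintegral_mono_set (hmono hij)
  refine tendsto_nhds_unique hlim ?_
  simp only [hpart]
  simpa using ENNReal.tendsto_ofReal (tendsto_const_nhds.sub hw' : Tendsto (fun k => w 0 - w k)
    atTop (𝓝 (w 0 - 0)))

/-- The value `2^{(n-n²)/2}` of the integrated tail at `2^n`. -/
def dyadicTail (n : ℕ) : ℝ := (2 : ℝ) ^ (((n : ℝ) - (n : ℝ) ^ 2) / 2)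

theorem dyadicTail_pos (n : ℕ) : 0 < dyadicTail n := Real.rpow_pos_of_pos two_pos _

theorem rpow_eq_dyadicTail_succ (n : ℕ) :
    (2 : ℝ) ^ ((-(n : ℝ) - (n : ℝ) ^ 2) / 2) = dyadicTail (n + 1) := by
  unfold dyadicTail
  congr 1
  push_cast
  ring

theorem dyadicTail_eq (n : ℕ) : dyadicTail n = dyadicTail (n + 1) * 2 ^ n := by
  rw [← rpow_eq_dyadicTail_succ, dyadicTail, ← Real.rpow_natCast 2 n, ← Real.rpow_add two_pos]
  congr 1
  ring

theorem dyadicTail_succ_eq (n : ℕ) :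
    dyadicTail (n + 1) =
      (2 : ℝ) ^ ((-3 * (n : ℝ) - (n : ℝ) ^ 2) / 2) * 2 ^ n := by
  rw [← rpow_eq_dyadicTail_succ, ← Real.rpow_natCast 2 n, ← Real.rpow_add two_pos]
  congr 1
  ring

theorem dyadicTail_antitone : Antitone dyadicTail := by
  refine antitone_nat_of_succ_le fun n => ?_
  rw [dyadicTail_eq n]
  exact le_mul_of_one_le_right (dyadicTail_pos _).le (one_le_pow₀ one_le_two)

theorem dyadicTail_two : dyadicTail 2 = 1 / 2 := by
  norm_num [dyadicTail, Real.rpow_neg_one]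

theorem tendsto_dyadicTail : Tendsto dyadicTail atTop (𝓝 0) := by
  rw [← tendsto_add_atTop_iff_nat 1]
  refine squeeze_zero (fun n => (dyadicTail_pos _).le) (g := fun n => (1 / 2 : ℝ) ^ n)
    (fun n => ?_) (tendsto_pow_atTop_nhds_zero_of_lt_one (by norm_num) (by norm_num))
  have h1 : dyadicTail n ≤ dyadicTail 0 := dyadicTail_antitone (Nat.zero_le n)
  have h0 : dyadicTail 0 = 1 := by simp [dyadicTail]
  rw [h0, dyadicTail_eq n] at h1
  rw [one_div, inv_pow, ← one_div]
  exact (le_div_iff₀ (by positivity)).2 h1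

/-- The class `𝒪ℒ` fails as soon as `F̄(x-1)/F̄(x)` is unbounded along a sequence. -/
theorem not_memOL_of_tendsto {F : Measure ℝ} {b : ℕ → ℝ} (hb : Tendsto b atTop atTop)
    (h : Tendsto (fun n => tail F (b n - 1) / tail F (b n)) atTop atTop) : ¬ MemOL F := by
  intro hOL
  obtain ⟨M, hM⟩ := ENNReal.exists_nat_gt (hOL 1 one_pos).ne
  refine absurd hM (not_lt.2 (le_limsup_of_frequently_le' (hb.frequently ?_)))
  refine (Eventually.frequently ?_)
  filter_upwards [h.eventually_ge_atTop (M : ℝ)] with n hn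
  rw [← ENNReal.ofReal_natCast]
  refine ENNReal.ofReal_le_of_le_toReal ?_
  rwa [ENNReal.toReal_div]

/-- Example 4.1, basic properties: for the distribution with `F̄(y) = 1/8`
on `[0,4)` and `F̄(y) = 2^{(-n-n²)/2} - 2^{(-3n-n²)/2}` on `[2^n, 2^{n+1})`, `n ≥ 2`:
(i) `F̄(2^n - 1)/F̄(2^n) → ∞`, so `F ∉ 𝒪ℒ`; (ii) the mean is `μ = ∫₀^∞ F̄ = 1`;
(iii) the integrated tail has tail `1 - x/8` on `[0,4)` and
`2^{(n-n²)/2} + (2^{(-3n-n²)/2} - 2^{(-n-n²)/2})(x - 2^n)` on `[2^n, 2^{n+1})`. -/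
theorem example41_basic (F : Measure ℝ) (hF : IsDistribution F)
    (htail0 : ∀ y : ℝ, 0 ≤ y → y < 4 → F (Set.Ioi y) = ENNReal.ofReal (1 / 8))
    (htail1 : ∀ n : ℕ, 2 ≤ n → ∀ y : ℝ, (2 : ℝ) ^ n ≤ y → y < (2 : ℝ) ^ (n + 1) →
      F (Set.Ioi y) = ENNReal.ofReal
        ((2 : ℝ) ^ ((-(n : ℝ) - (n : ℝ) ^ 2) / 2) -
         (2 : ℝ) ^ ((-3 * (n : ℝ) - (n : ℝ) ^ 2) / 2))) :
    (Filter.Tendsto (fun n : ℕ => tail F ((2 : ℝ) ^ n - 1) / tail F ((2 : ℝ) ^ n))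
        Filter.atTop Filter.atTop ∧ ¬ MemOL F) ∧
    (∫⁻ y in Set.Ioi (0 : ℝ), F (Set.Ioi y) ∂volume) = 1 ∧
    ((∀ z : ℝ, 0 ≤ z → z < 4 →
        (∫⁻ y in Set.Ioi z, F (Set.Ioi y) ∂volume) = ENNReal.ofReal (1 - z / 8)) ∧
      (∀ n : ℕ, 2 ≤ n → ∀ z : ℝ, (2 : ℝ) ^ n ≤ z → z < (2 : ℝ) ^ (n + 1) →
        (∫⁻ y in Set.Ioi z, F (Set.Ioi y) ∂volume) = ENNReal.ofReal
          ((2 : ℝ) ^ (((n : ℝ) - (n : ℝ) ^ 2) / 2) +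
           ((2 : ℝ) ^ ((-3 * (n : ℝ) - (n : ℝ) ^ 2) / 2) -
            (2 : ℝ) ^ ((-(n : ℝ) - (n : ℝ) ^ 2) / 2)) * (z - (2 : ℝ) ^ n)))) := by
  set d : ℕ → ℝ := fun n => (2 : ℝ) ^ ((-3 * (n : ℝ) - (n : ℝ) ^ 2) / 2)
  have hdw : ∀ n, dyadicTail (n + 1) = d n * 2 ^ n := dyadicTail_succ_eq
  have hdpos : ∀ n, 0 < d n := fun n => Real.rpow_pos_of_pos two_pos _
  have hpow : ∀ n : ℕ, (1 : ℝ) ≤ 2 ^ n := fun n => one_le_pow₀ one_le_two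
  have hc : ∀ n, 0 ≤ dyadicTail (n + 1) - d n := fun n => by
    rw [hdw, sub_nonneg]
    exact le_mul_of_one_le_right (hdpos n).le (hpow n)
  simp only [rpow_eq_dyadicTail_succ] at htail1 ⊢
  have hpow_mono : Monotone fun n : ℕ => (2 : ℝ) ^ n := pow_right_mono₀ one_le_two
  have hpow_top : Tendsto (fun n : ℕ => (2 : ℝ) ^ n) atTop atTop :=
    tendsto_pow_atTop_atTop_of_one_lt one_lt_two
  have hdyadic : ∀ n, 2 ≤ n →
      ∫⁻ y in Ici ((2 : ℝ) ^ n), F (Ioi y) = ENNReal.ofReal (dyadicTail n) := by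
    intro n hn
    have hshift : Tendsto (fun k : ℕ => n + k) atTop atTop :=
      tendsto_atTop_mono (fun k => Nat.le_add_left k n) tendsto_id
    have hshift_mono : Monotone fun k : ℕ => n + k := fun i j h => Nat.add_le_add_left h n
    refine setLIntegral_Ici_of_telescoping (b := fun k => (2 : ℝ) ^ (n + k))
      (w := fun k => dyadicTail (n + k)) (hpow_mono.comp hshift_mono) (hpow_top.comp hshift)
      (dyadicTail_antitone.comp_monotone hshift_mono) (tendsto_dyadicTail.comp hshift)
      fun k => ?_
    rw [← add_assoc n k 1,
      setLIntegral_Ico_of_eqOn_const (hc (n + k)) (htail1 (n + k) (by omega))]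
    congr 1
    rw [dyadicTail_eq (n + k), pow_succ]
    linear_combination hdw (n + k)
  have hzero : ∀ z : ℝ, 0 ≤ z → z < 4 →
      ∫⁻ y in Ioi z, F (Ioi y) = ENNReal.ofReal (1 - z / 8) := by
    intro z hz hz4
    have h4 := hdyadic 2 le_rfl
    rw [dyadicTail_two, show (2 : ℝ) ^ 2 = 4 by norm_num] at h4
    rw [setLIntegral_congr Ioi_ae_eq_Ici, setLIntegral_Ici_eq_add hz4.le, h4,
      setLIntegral_Ico_of_eqOn_const (by norm_num)
        (fun y hy hy4 => htail0 y (hz.trans hy) hy4),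
      ← ENNReal.ofReal_add (by linarith) (by norm_num)]
    congr 1
    ring
  have htendsto : Tendsto (fun n : ℕ => tail F ((2 : ℝ) ^ n - 1) / tail F ((2 : ℝ) ^ n))
      atTop atTop := by
    refine tendsto_atTop_mono' _ ?_ (tendsto_atTop_add_const_right atTop (-2 : ℝ) hpow_top)
    filter_upwards [eventually_ge_atTop 3] with m hm
    obtain ⟨n, rfl⟩ : ∃ n, m = n + 1 := ⟨m - 1, by omega⟩
    have hp := hpow n
    have hs : (2 : ℝ) ^ (n + 1) = 2 * 2 ^ n := by ring
    have hlt : (2 : ℝ) ^ (n + 1) < 2 ^ (n + 1 + 1) := pow_lt_pow_right₀ one_lt_two (by omega)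
    rw [tail, tail, htail1 n (by omega) _ (by linarith) (by linarith),
      htail1 (n + 1) (by omega) _ le_rfl hlt, ENNReal.toReal_ofReal (hc _),
      ENNReal.toReal_ofReal (hc _)]
    have e1 := hdw n
    have e2 := hdw (n + 1)
    have e3 := dyadicTail_eq (n + 1)
    have hd1 := hdpos (n + 1)
    change _ ≤ (dyadicTail (n + 1) - d n) / (dyadicTail (n + 1 + 1) - d (n + 1))
    have hden : 0 < dyadicTail (n + 1 + 1) - d (n + 1) := by
      rw [e2, hs]
      nlinarith
    rw [le_div_iff₀ hden]
    have hdn : d n = d (n + 1) * (4 * 2 ^ n) := by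
      have hne : (2 : ℝ) ^ n ≠ 0 := by positivity
      apply mul_right_cancel₀ hne
      rw [← e1, e3, e2, hs]
      ring
    rw [e3, hdn, e2, hs]
    nlinarith
  refine ⟨⟨htendsto, not_memOL_of_tendsto hpow_top htendsto⟩, ?_, hzero, ?_⟩
  · simpa using hzero 0 le_rfl (by norm_num)
  · intro n hn z hz hz'
    have hpos := mul_nonneg (hc n) (sub_nonneg.2 hz'.le)
    rw [setLIntegral_congr Ioi_ae_eq_Ici, setLIntegral_Ici_eq_add hz'.le,
      hdyadic (n + 1) (by omega),
      setLIntegral_Ico_of_eqOn_const (hc n)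
        (fun y hy hy' => htail1 n hn y (hz.trans hy) hy'),
      ← ENNReal.ofReal_add hpos (dyadicTail_pos _).le]
    congr 1
    change _ = dyadicTail n + (d n - dyadicTail (n + 1)) * (z - 2 ^ n)
    rw [dyadicTail_eq n, pow_succ]
    linear_combination hdw n
end
end
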